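/- For every bounded continuous function F on P(E), the limit lim_{n→∞} (1/n) ρ_n(n F ∘ L_n) exists and equals sup_{ν ∈ P(E)} (F(ν) − α(ν)). -/

import Mathlib

open MeasureTheory ProbabilityTheory Filter Topology Set
open scoped ENNReal NNReal

noncomputable section

namespace SanovDual

attribute [local instance] Classical.propDecidable

/-- The integral of an `EReal`-valued function, with the convention `∞ - ∞ := -∞`. -/
def erealIntegral {X : Type*} [MeasurableSpace X] (μ : Measure X) (f : X → EReal) : EReal :=
  if (∫⁻ x, (if f x = ⊥ then ⊤ else ENNReal.ofReal (-(f x).toReal)) ∂μ) = ⊤ then ⊥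
  else ((∫⁻ x, (if f x = ⊤ then ⊤ else ENNReal.ofReal ((f x).toReal)) ∂μ : ℝ≥0∞) : EReal)
      - ((∫⁻ x, (if f x = ⊥ then ⊤ else ENNReal.ofReal (-(f x).toReal)) ∂μ : ℝ≥0∞) : EReal)

/-- Extension of a function on probability measures to all measures (value `∞` elsewhere). -/
def extend {E : Type*} [MeasurableSpace E] (α : ProbabilityMeasure E → EReal)
    (μ : Measure E) : EReal :=
  if h : IsProbabilityMeasure μ then α ⟨μ, h⟩ else ⊤

/-- The conditional law of the `k`-th coordinate given the first `k` coordinates (`0`-indexed: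
given coordinates `0, …, k-1`), under a probability measure on `Fin n → E`. -/
def condLaw {E : Type*} [MeasurableSpace E] [TopologicalSpace E] [PolishSpace E] [BorelSpace E]
    [Nonempty E] (n : ℕ) (ν : ProbabilityMeasure (Fin n → E)) (k : Fin n) :
    Kernel (Fin (k : ℕ) → E) E :=
  Measure.condKernel ((ν : Measure (Fin n → E)).map
      (fun x => ((fun i : Fin (k : ℕ) => x (Fin.castLE k.isLt.le i)), x k)))

/-- The functional `α_n` on `P(E^n)` built from `α` by summing `α` applied to the successive
conditional laws in the disintegration. -/
def alphan {E : Type*} [MeasurableSpace E] [TopologicalSpace E] [PolishSpace E] [BorelSpace E]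
    [Nonempty E] (α : ProbabilityMeasure E → EReal) (n : ℕ)
    (ν : ProbabilityMeasure (Fin n → E)) : EReal :=
  ∑ k : Fin n, erealIntegral (ν : Measure (Fin n → E))
    (fun x => extend α (condLaw n ν k (fun i => x (Fin.castLE k.isLt.le i))))

/-- The convex conjugate `ρ_n` of `α_n`, acting on (extended-real-valued) functions on `E^n`. -/
def rhon {E : Type*} [MeasurableSpace E] [TopologicalSpace E] [PolishSpace E] [BorelSpace E]
    [Nonempty E] (α : ProbabilityMeasure E → EReal) (n : ℕ) (f : (Fin n → E) → EReal) : EReal :=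
  ⨆ ν : ProbabilityMeasure (Fin n → E), erealIntegral (ν : Measure (Fin n → E)) f - alphan α n ν

/-- `ρ = ρ₁` on bounded (real-valued) functions. -/
def rho {E : Type*} [MeasurableSpace E] (α : ProbabilityMeasure E → EReal) (f : E → ℝ) : EReal :=
  ⨆ ν : ProbabilityMeasure E, ((∫ x, f x ∂(ν : Measure E) : ℝ) : EReal) - α ν

/-- `ρ` on extended-real-valued functions, with the convention `∞ - ∞ := -∞` for integrals. -/
def rhoE {E : Type*} [MeasurableSpace E] (α : ProbabilityMeasure E → EReal) (f : E → EReal) :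
    EReal :=
  ⨆ ν : ProbabilityMeasure E, erealIntegral (ν : Measure E) f - α ν

/-- `ρ` on `[0,∞]`-valued functions. -/
def rhoNN {E : Type*} [MeasurableSpace E] (α : ProbabilityMeasure E → EReal) (g : E → ℝ≥0∞) :
    EReal :=
  ⨆ ν : ProbabilityMeasure E, ((∫⁻ x, g x ∂(ν : Measure E) : ℝ≥0∞) : EReal) - α ν

/-- The empirical measure `L_n(x) = n⁻¹ ∑ δ_{x_i}` as a measure. -/
def empMeasure {E : Type*} [MeasurableSpace E] (n : ℕ) (x : Fin n → E) : Measure E :=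
  (n : ℝ≥0∞)⁻¹ • ∑ i : Fin n, Measure.dirac (x i)

/-- The empirical measure `L_n(x)` as a probability measure (junk value for `n = 0`). -/
def empirical {E : Type*} [MeasurableSpace E] [Nonempty E] (n : ℕ) (x : Fin n → E) :
    ProbabilityMeasure E :=
  if h : IsProbabilityMeasure (empMeasure n x) then ⟨empMeasure n x, h⟩
  else ⟨Measure.dirac (Classical.arbitrary E), inferInstance⟩

/-- `P_ψ(E)`, the probability measures integrating `ψ`. -/
def Pw (E : Type*) [MeasurableSpace E] (ψ : E → ℝ) : Type _ :=
  {ν : ProbabilityMeasure E // ∫⁻ x, ENNReal.ofReal (ψ x) ∂(ν : Measure E) ≠ ⊤}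

/-- The underlying probability measure of an element of `P_ψ(E)`. -/
def Pw.toProb {E : Type*} [MeasurableSpace E] {ψ : E → ℝ} (ν : Pw E ψ) :
    ProbabilityMeasure E :=
  Subtype.val ν

/-- The `ψ`-weak topology on `P_ψ(E)`: the topology generated by the maps `ν ↦ ∫ f dν` over
continuous `f : E → ℝ` with `|f| ≤ 1 + ψ`. -/
instance {E : Type*} [MeasurableSpace E] [TopologicalSpace E] (ψ : E → ℝ) :
    TopologicalSpace (Pw E ψ) :=
  ⨅ (f : E → ℝ) (_ : Continuous f) (_ : ∀ x, |f x| ≤ 1 + ψ x),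
    TopologicalSpace.induced (fun ν : Pw E ψ => ∫ x, f x ∂(ν.toProb : Measure E)) inferInstance

/-- Lift a function on `P_ψ(E)` to one on `P(E)` (junk value `⊤` off `P_ψ(E)`). -/
def liftPw {E : Type*} [MeasurableSpace E] (ψ : E → ℝ) (F : Pw E ψ → EReal)
    (ν : ProbabilityMeasure E) : EReal :=
  if h : ∫⁻ x, ENNReal.ofReal (ψ x) ∂(ν : Measure E) ≠ ⊤ then F ⟨ν, h⟩ else ⊤

/-- The canonical map `EReal → ℝ≥0∞`. -/
def erealToENNReal (x : EReal) : ℝ≥0∞ :=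
  if x = ⊤ then ⊤ else ENNReal.ofReal x.toReal

instance {E : Type*} [MeasurableSpace E] : MeasurableSpace (ProbabilityMeasure E) :=
  Subtype.instMeasurableSpace

section ProbabilityMeasures

variable {E : Type*} [MeasurableSpace E] [TopologicalSpace E]

open BoundedContinuousFunction in
lemma nhds_probabilityMeasure_eq [OpensMeasurableSpace E] (μ : ProbabilityMeasure E) :
    𝓝 μ = ⨅ f : E →ᵇ ℝ, comap (fun p : ProbabilityMeasure E => ∫ x, f x ∂(p : Measure E))
      (𝓝 (∫ x, f x ∂(μ : Measure E))) := by
  refine le_antisymm ?_ ?_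
  · refine le_iInf fun f => ?_
    rw [← map_le_iff_le_comap]
    exact (ProbabilityMeasure.tendsto_iff_forall_integral_tendsto.1 tendsto_id) f
  · have : Tendsto (id : ProbabilityMeasure E → ProbabilityMeasure E)
        (⨅ f : E →ᵇ ℝ, comap (fun p : ProbabilityMeasure E => ∫ x, f x ∂(p : Measure E))
          (𝓝 (∫ x, f x ∂(μ : Measure E)))) (𝓝 μ) := by
      rw [ProbabilityMeasure.tendsto_iff_forall_integral_tendsto]
      intro f
      exact (tendsto_comap.mono_left (iInf_le _ f))
    exact this

open BoundedContinuousFunction in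
/-- Near a compact set, a continuous function on `P(E)` is uniformly controlled by finitely many
integrals of bounded continuous functions. -/
lemma IsCompact.exists_finite_test_functions [OpensMeasurableSpace E]
    {K : Set (ProbabilityMeasure E)} (hK : IsCompact K)
    {F : ProbabilityMeasure E → ℝ} (hF : Continuous F) {ε : ℝ} (hε : 0 < ε) :
    ∃ (T : Set (E →ᵇ ℝ)) (δ : (E →ᵇ ℝ) → ℝ), T.Finite ∧ (∀ f ∈ T, 0 < δ f) ∧
      ∀ μ ∈ K, ∀ μ' : ProbabilityMeasure E,
        (∀ f ∈ T, |∫ x, f x ∂(μ' : Measure E) - ∫ x, f x ∂(μ : Measure E)| < δ f) →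
          |F μ' - F μ| < ε := by
  let φ : (E →ᵇ ℝ) → ProbabilityMeasure E × ProbabilityMeasure E → ℝ := fun f p =>
    ∫ x, f x ∂(p.2 : Measure E) - ∫ x, f x ∂(p.1 : Measure E)
  let G : Filter (ProbabilityMeasure E × ProbabilityMeasure E) :=
    ⨅ f : E →ᵇ ℝ, comap (φ f) (𝓝 0)
  have hgood : {p : ProbabilityMeasure E × ProbabilityMeasure E |
      p.1 ∈ K → |F p.2 - F p.1| < ε} ∈ G := by
    rw [mem_iff_ultrafilter]
    intro U hU
    by_contra hbad
    rw [← Ultrafilter.compl_mem_iff_notMem] at hbad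
    have hUK : (U.map Prod.fst : Filter (ProbabilityMeasure E)) ≤ 𝓟 K := by
      rw [le_principal_iff, Ultrafilter.coe_map, mem_map]
      filter_upwards [hbad] with p hp
      by_contra h
      exact hp fun h' => absurd h' h
    obtain ⟨μ₀, -, hμ₀⟩ := hK.ultrafilter_le_nhds (U.map Prod.fst) hUK
    have h1 : Tendsto Prod.fst (U : Filter (ProbabilityMeasure E × ProbabilityMeasure E)) (𝓝 μ₀) :=
      hμ₀
    have h2 : Tendsto Prod.snd (U : Filter (ProbabilityMeasure E × ProbabilityMeasure E))
        (𝓝 μ₀) := by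
      rw [ProbabilityMeasure.tendsto_iff_forall_integral_tendsto] at h1 ⊢
      intro f
      have h3 : Tendsto (φ f) U (𝓝 0) := tendsto_comap.mono_left (hU.trans (iInf_le _ f))
      simpa [φ] using h3.add (h1 f)
    have h4 : Tendsto (fun p : ProbabilityMeasure E × ProbabilityMeasure E => |F p.2 - F p.1|) U
        (𝓝 |F μ₀ - F μ₀|) := (((hF.tendsto _).comp h2).sub ((hF.tendsto _).comp h1)).abs
    have h5 := h4.eventually_lt_const (u := ε) (by simpa using hε)
    obtain ⟨p, hp, hp'⟩ := (h5.and hbad).exists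
    exact hp' fun _ => hp
  have hb := HasBasis.iInf' (fun f : E →ᵇ ℝ => (Metric.nhds_basis_ball (x := (0 : ℝ))).comap (φ f))
  obtain ⟨⟨T, δ⟩, ⟨hT, hδ⟩, hsub⟩ := hb.mem_iff.1 hgood
  refine ⟨T, δ, hT, hδ, fun μ hμ μ' h => ?_⟩
  refine @hsub (μ, μ') ?_ hμ
  simp only [mem_iInter, mem_preimage, Metric.mem_ball, dist_zero_right, Real.norm_eq_abs]
  exact h

open BoundedContinuousFunction in
lemma measurableSet_preimage_of_isCompact [BorelSpace E] [PolishSpace E]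
    {Y : Type*} [MeasurableSpace Y] {g : Y → ProbabilityMeasure E}
    (hg : ∀ f : E →ᵇ ℝ, Measurable fun y => ∫ x, f x ∂(g y : Measure E))
    {K : Set (ProbabilityMeasure E)} (hK : IsCompact K) : MeasurableSet (g ⁻¹' K) := by
  let _ := TopologicalSpace.metrizableSpaceMetric (ProbabilityMeasure E)
  have key : ∀ n : ℕ, ∃ S : Set (ProbabilityMeasure E), K ⊆ S ∧
      S ⊆ Metric.thickening (1 / ((n : ℝ) + 1)) K ∧ MeasurableSet (g ⁻¹' S) := by
    intro n
    have hV : Metric.thickening (1 / ((n : ℝ) + 1)) K ∈ 𝓝ˢ K :=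
      Metric.isOpen_thickening.mem_nhdsSet.2 (Metric.self_subset_thickening (by positivity) K)
    have hloc : ∀ μ ∈ K, ∃ W ∈ 𝓝 μ, W ⊆ Metric.thickening (1 / ((n : ℝ) + 1)) K ∧
        MeasurableSet (g ⁻¹' W) := by
      intro μ hμ
      have hμV := mem_nhdsSet_iff_forall.1 hV μ hμ
      have hb := HasBasis.iInf' (fun f : E →ᵇ ℝ =>
        (Metric.nhds_basis_ball (x := ∫ x, f x ∂(μ : Measure E))).comap
          (fun p : ProbabilityMeasure E => ∫ x, f x ∂(p : Measure E)))
      rw [← nhds_probabilityMeasure_eq] at hb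
      obtain ⟨⟨T, δ⟩, ⟨hT, hδ⟩, hsub⟩ := hb.mem_iff.1 hμV
      refine ⟨_, hb.mem_of_mem ⟨hT, hδ⟩, hsub, ?_⟩
      simp only [preimage_iInter]
      exact hT.measurableSet_biInter fun f _ => (hg f) measurableSet_ball
    choose! W hW1 hW2 hW3 using hloc
    obtain ⟨t, htK, ht⟩ := hK.elim_nhds_subcover W hW1
    refine ⟨⋃ x ∈ t, W x, ht, iUnion₂_subset fun x hx => hW2 x (htK x hx), ?_⟩
    simp only [preimage_iUnion]
    exact t.measurableSet_biUnion fun x hx => hW3 x (htK x hx)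
  choose S hS1 hS2 hS3 using key
  have : K = ⋂ n, S n := by
    refine Subset.antisymm (subset_iInter hS1) fun μ hμ => ?_
    rw [← hK.isClosed.closure_eq, Metric.closure_eq_iInter_thickening]
    simp only [mem_iInter] at hμ ⊢
    intro δ hδ
    obtain ⟨n, hn⟩ := exists_nat_one_div_lt hδ
    exact Metric.thickening_mono hn.le _ (hS2 n (hμ n))
  rw [this, preimage_iInter]
  exact MeasurableSet.iInter hS3

lemma exists_le_of_isCompact_sublevel [OpensMeasurableSpace E] [HasOuterApproxClosed E]
    [BorelSpace E]
    {α : ProbabilityMeasure E → EReal} (hbot : ∀ ν, α ν ≠ ⊥)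
    (hcompact : ∀ c : ℝ, IsCompact {ν : ProbabilityMeasure E | α ν ≤ (c : EReal)}) :
    ∃ m : ℝ, ∀ ν, (m : EReal) ≤ α ν := by
  by_contra! h
  have hne := IsCompact.nonempty_iInter_of_sequence_nonempty_isCompact_isClosed
    (fun n : ℕ => {ν : ProbabilityMeasure E | α ν ≤ ((-(n : ℝ) : ℝ) : EReal)})
    (fun n ν hν => le_trans (α := EReal) hν (by
      rw [EReal.coe_le_coe_iff]; push_cast; linarith))
    (fun n => (h (-(n : ℝ))).imp fun ν hν => le_of_lt (α := EReal) hν)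
    (hcompact _) (fun n => (hcompact _).isClosed)
  obtain ⟨ν, hν⟩ := hne
  simp only [mem_iInter, mem_ofPred_eq] at hν
  obtain ⟨r, hr⟩ : ∃ r : ℝ, α ν = r :=
    ⟨(α ν).toReal, (EReal.coe_toReal (ne_top_of_le_ne_top (EReal.coe_ne_top _) (hν 0))
      (hbot ν)).symm⟩
  obtain ⟨n, hn⟩ := exists_nat_gt (-r)
  have := hν n
  rw [hr, EReal.coe_le_coe_iff] at this
  linarith

/-- The uniform mixture `n⁻¹ ∑ p_k` of probability measures. -/
def uniformMixture {n : ℕ} [NeZero n] (p : Fin n → ProbabilityMeasure E) :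
    ProbabilityMeasure E :=
  ⟨(n : ℝ≥0∞)⁻¹ • ∑ k, (p k : Measure E), ⟨by
    simp [ENNReal.inv_mul_cancel (Nat.cast_ne_zero.2 (NeZero.ne n)) (ENNReal.natCast_ne_top n)]⟩⟩

omit [TopologicalSpace E] in
lemma integral_uniformMixture {n : ℕ} [NeZero n] (p : Fin n → ProbabilityMeasure E) {f : E → ℝ}
    (hf : ∀ k, Integrable f (p k : Measure E)) :
    ∫ x, f x ∂(uniformMixture p : Measure E) = (n : ℝ)⁻¹ * ∑ k, ∫ x, f x ∂(p k : Measure E) := by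
  change ∫ x, f x ∂((n : ℝ≥0∞)⁻¹ • ∑ k, (p k : Measure E)) = _
  rw [integral_smul_measure, integral_finsetSum_measure fun k _ => hf k]
  simp

omit [TopologicalSpace E] in
lemma uniformMixture_const {n : ℕ} [NeZero n] (p : ProbabilityMeasure E) :
    uniformMixture (fun _ : Fin n => p) = p := by
  apply Subtype.ext
  change (n : ℝ≥0∞)⁻¹ • ∑ k : Fin n, (p : Measure E) = p
  rw [Finset.sum_const, Finset.card_univ, Fintype.card_fin, ← Nat.cast_smul_eq_nsmul ℝ≥0∞,
    smul_smul, ENNReal.inv_mul_cancel (Nat.cast_ne_zero.2 (NeZero.ne n)) (ENNReal.natCast_ne_top n),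
    one_smul]

omit [TopologicalSpace E] in
lemma empirical_eq_uniformMixture [Nonempty E] {n : ℕ} [NeZero n] (x : Fin n → E) :
    empirical n x = uniformMixture fun k => diracProba (x k) := by
  have h : empMeasure n x =
      (uniformMixture fun k => diracProba (x k) : ProbabilityMeasure E) := rfl
  have hp : IsProbabilityMeasure (empMeasure n x) := by rw [h]; infer_instance
  exact (dif_pos hp).trans (Subtype.ext h)

open BoundedContinuousFunction in
lemma integral_empirical [OpensMeasurableSpace E] [Nonempty E]
    {n : ℕ} [NeZero n] (x : Fin n → E) (f : E →ᵇ ℝ) :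
    ∫ y, f y ∂(empirical n x : Measure E) = (n : ℝ)⁻¹ * ∑ k, f (x k) := by
  rw [empirical_eq_uniformMixture, integral_uniformMixture _ fun k => f.integrable _]
  congr 1
  refine Finset.sum_congr rfl fun k _ => ?_
  exact integral_dirac' _ _ f.continuous.measurable.stronglyMeasurable

lemma continuous_empirical [OpensMeasurableSpace E] [Nonempty E]
    {n : ℕ} [NeZero n] : Continuous fun x : Fin n → E => empirical n x := by
  rw [ProbabilityMeasure.continuous_iff_forall_continuous_integral]
  intro f
  simp only [integral_empirical]
  fun_prop

omit [TopologicalSpace E] in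
lemma extend_coe (α : ProbabilityMeasure E → EReal) (μ : ProbabilityMeasure E) :
    extend α (μ : Measure E) = α μ :=
  dif_pos μ.2

omit [TopologicalSpace E] in
lemma le_average_of_convex_succ {α : ProbabilityMeasure E → EReal}
    (hconvex : ∀ (μ₁ μ₂ : ProbabilityMeasure E) (t : ℝ≥0), t ≤ 1 →
      extend α ((t : ℝ≥0∞) • (μ₁ : Measure E) + ((1 - t : ℝ≥0) : ℝ≥0∞) • (μ₂ : Measure E))
        ≤ ((t : ℝ) : EReal) * α μ₁ + (((1 - t : ℝ≥0) : ℝ) : EReal) * α μ₂)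
    (n : ℕ) (p : Fin (n + 1) → ProbabilityMeasure E) (a : Fin (n + 1) → ℝ)
    (ha : ∀ k, α (p k) ≤ a k) :
    α (uniformMixture p) ≤ ((((n + 1 : ℕ) : ℝ)⁻¹ * ∑ k, a k : ℝ) : EReal) := by
  induction n with
  | zero =>
    have hp : p = fun _ => p 0 := by ext1 k; rw [Fin.fin_one_eq_zero k]
    rw [hp, uniformMixture_const]
    simpa using ha 0
  | succ n ih =>
    let t : ℝ≥0 := (n + 1) / (n + 2)
    have ht : t ≤ 1 := by
      rw [div_le_one (by positivity)]; gcongr; norm_num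
    have ht' : ((1 - t : ℝ≥0) : ℝ) = ((n : ℝ) + 2)⁻¹ := by
      rw [NNReal.coe_sub ht]; simp only [t]; push_cast; field_simp; ring
    have ht'' : (1 - t : ℝ≥0) = ((n : ℝ≥0) + 2)⁻¹ := by
      rw [← NNReal.coe_inj, ht']; push_cast; rfl
    have h := hconvex (uniformMixture fun k : Fin (n + 1) => p k.castSucc) (p (Fin.last _)) t ht
    have hmix : (t : ℝ≥0∞) • ((uniformMixture fun k : Fin (n + 1) => p k.castSucc :
        ProbabilityMeasure E) : Measure E)
        + ((1 - t : ℝ≥0) : ℝ≥0∞) • (p (Fin.last _) : Measure E) = uniformMixture p := by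
      change (t : ℝ≥0∞) • (((n + 1 : ℕ) : ℝ≥0∞)⁻¹ • ∑ k : Fin (n + 1), (p k.castSucc : Measure E))
        + ((1 - t : ℝ≥0) : ℝ≥0∞) • (p (Fin.last _) : Measure E) =
        ((n + 1 + 1 : ℕ) : ℝ≥0∞)⁻¹ • ∑ k, (p k : Measure E)
      have e1 : (t : ℝ≥0∞) * ((n + 1 : ℕ) : ℝ≥0∞)⁻¹ = ((n + 1 + 1 : ℕ) : ℝ≥0∞)⁻¹ := by
        have : t * ((n + 1 : ℕ) : ℝ≥0)⁻¹ = ((n + 1 + 1 : ℕ) : ℝ≥0)⁻¹ := by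
          simp only [t]; push_cast; field_simp; ring
        have := congrArg (fun z : ℝ≥0 => (z : ℝ≥0∞)) this
        simpa [ENNReal.coe_inv] using this
      have e2 : ((1 - t : ℝ≥0) : ℝ≥0∞) = ((n + 1 + 1 : ℕ) : ℝ≥0∞)⁻¹ := by
        have h2 : (1 - t : ℝ≥0) = ((n + 1 + 1 : ℕ) : ℝ≥0)⁻¹ := by
          rw [ht'']; push_cast; ring
        rw [h2, ENNReal.coe_inv (by positivity)]; simp
      rw [smul_smul, e1, e2, Fin.sum_univ_castSucc (n := n + 1), smul_add]
    rw [hmix, extend_coe] at h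
    have hi := ih (fun k => p k.castSucc) (fun k => a k.castSucc) fun k => ha _
    refine h.trans ((add_le_add (mul_le_mul_of_nonneg_left hi ?_)
      (mul_le_mul_of_nonneg_left (ha _) ?_)).trans ?_)
    · exact_mod_cast t.2
    · exact_mod_cast (1 - t).2
    · rw [← EReal.coe_mul, ← EReal.coe_mul, ← EReal.coe_add, EReal.coe_le_coe_iff, ht',
        Fin.sum_univ_castSucc (n := n + 1)]
      simp only [t]
      push_cast
      apply le_of_eq
      field_simp
      ring

omit [TopologicalSpace E] in
lemma le_average_of_convex {α : ProbabilityMeasure E → EReal}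
    (hconvex : ∀ (μ₁ μ₂ : ProbabilityMeasure E) (t : ℝ≥0), t ≤ 1 →
      extend α ((t : ℝ≥0∞) • (μ₁ : Measure E) + ((1 - t : ℝ≥0) : ℝ≥0∞) • (μ₂ : Measure E))
        ≤ ((t : ℝ) : EReal) * α μ₁ + (((1 - t : ℝ≥0) : ℝ) : EReal) * α μ₂)
    {n : ℕ} [NeZero n] (p : Fin n → ProbabilityMeasure E) (a : Fin n → ℝ)
    (ha : ∀ k, α (p k) ≤ a k) :
    α (uniformMixture p) ≤ (((n : ℝ)⁻¹ * ∑ k, a k : ℝ) : EReal) := by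
  obtain ⟨n, rfl⟩ : ∃ m, n = m + 1 := Nat.exists_eq_succ_of_ne_zero (NeZero.ne n)
  exact le_average_of_convex_succ hconvex n p a ha

section Conditional

variable [PolishSpace E] [BorelSpace E] [Nonempty E]

instance isMarkovKernel_condLaw {n : ℕ} (ν : ProbabilityMeasure (Fin n → E)) (k : Fin n) :
    IsMarkovKernel (condLaw n ν k) := by
  unfold condLaw; infer_instance

/-- The first `k` coordinates of a point of `E^n`. -/
abbrev past {n : ℕ} (k : Fin n) (x : Fin n → E) : Fin (k : ℕ) → E :=
  fun i => x (Fin.castLE k.isLt.le i)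

/-- The conditional law of the `k`-th coordinate along `x`, as a probability measure. -/
def condProb {n : ℕ} (ν : ProbabilityMeasure (Fin n → E)) (k : Fin n) (x : Fin n → E) :
    ProbabilityMeasure E :=
  ⟨condLaw n ν k (past k x), inferInstance⟩

omit [TopologicalSpace E] [PolishSpace E] [BorelSpace E] [Nonempty E] in
lemma measurable_past {n : ℕ} (k : Fin n) : Measurable (past (E := E) k) := by
  unfold past; fun_prop

lemma measurable_integral_condLaw {n : ℕ} (ν : ProbabilityMeasure (Fin n → E)) (k : Fin n)
    {f : E → ℝ} (hf : Measurable f) :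
    Measurable fun y : Fin (k : ℕ) → E => ∫ z, f z ∂(condLaw n ν k y) :=
  (hf.stronglyMeasurable.integral_kernel (κ := condLaw n ν k)).measurable

lemma integral_mul_condLaw {n : ℕ} (ν : ProbabilityMeasure (Fin n → E)) (k : Fin n)
    {f : E → ℝ} (hf : Measurable f) {B : ℝ} (hfB : ∀ x, |f x| ≤ B)
    {G : (Fin (k : ℕ) → E) → ℝ} (hG : Measurable G) {A : ℝ} (hGA : ∀ y, |G y| ≤ A) :
    ∫ x, G (past k x) * f (x k) ∂(ν : Measure (Fin n → E)) =
      ∫ x, G (past k x) * (∫ z, f z ∂(condLaw n ν k (past k x)))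
        ∂(ν : Measure (Fin n → E)) := by
  let pr : (Fin n → E) → (Fin (k : ℕ) → E) × E := fun x => (past k x, x k)
  have hpr : Measurable pr := (measurable_past k).prodMk (measurable_pi_apply k)
  let μ : Measure ((Fin (k : ℕ) → E) × E) := (ν : Measure (Fin n → E)).map pr
  let g : (Fin (k : ℕ) → E) × E → ℝ := fun p => G p.1 * f p.2
  have hg : Measurable g := by fun_prop
  have : IsProbabilityMeasure μ := Measure.isProbabilityMeasure_map hpr.aemeasurable
  have hgi : Integrable g (μ.fst ⊗ₘ condLaw n ν k) := by
    refine Integrable.of_bound hg.aestronglyMeasurable (A * B) (ae_of_all _ fun p => ?_)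
    rw [Real.norm_eq_abs, abs_mul]
    exact mul_le_mul (hGA _) (hfB _) (abs_nonneg _) ((abs_nonneg _).trans (hGA p.1))
  have hdis : μ.fst ⊗ₘ condLaw n ν k = μ := Measure.disintegrate μ μ.condKernel
  have hfst : μ.fst = (ν : Measure (Fin n → E)).map (past k) :=
    Measure.fst_map_prodMk (measurable_pi_apply k)
  calc ∫ x, G (past k x) * f (x k) ∂(ν : Measure (Fin n → E))
      = ∫ p, g p ∂μ := (integral_map hpr.aemeasurable hg.aestronglyMeasurable).symm
    _ = ∫ p, g p ∂(μ.fst ⊗ₘ condLaw n ν k) := by rw [hdis]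
    _ = ∫ y, G y * ∫ z, f z ∂(condLaw n ν k y) ∂μ.fst := by
        rw [Measure.integral_compProd hgi]
        simp only [g, integral_const_mul]
    _ = _ := by
        rw [hfst, integral_map (measurable_past k).aemeasurable]
        exact (hG.mul (measurable_integral_condLaw ν k hf)).aestronglyMeasurable

/-- The increment `f(x_k) - E[f(x_k) | x_0, …, x_{k-1}]`. -/
def increment {n : ℕ} (ν : ProbabilityMeasure (Fin n → E)) (f : E → ℝ) (k : Fin n)
    (x : Fin n → E) : ℝ :=
  f (x k) - ∫ z, f z ∂(condLaw n ν k (past k x))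

lemma measurable_increment {n : ℕ} (ν : ProbabilityMeasure (Fin n → E)) (k : Fin n)
    {f : E → ℝ} (hf : Measurable f) : Measurable (increment ν f k) :=
  (hf.comp (measurable_pi_apply k)).sub ((measurable_integral_condLaw ν k hf).comp
    (measurable_past k))

lemma abs_integral_condLaw_le {n : ℕ} (ν : ProbabilityMeasure (Fin n → E)) (k : Fin n)
    {f : E → ℝ} {B : ℝ} (hfB : ∀ x, |f x| ≤ B) (y : Fin (k : ℕ) → E) :
    |∫ z, f z ∂(condLaw n ν k y)| ≤ B := by
  simpa using norm_integral_le_of_norm_le_const (μ := condLaw n ν k y) (f := f) (C := B)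
    (ae_of_all _ fun z => by simpa using hfB z)

lemma abs_increment_le {n : ℕ} (ν : ProbabilityMeasure (Fin n → E)) (k : Fin n)
    {f : E → ℝ} {B : ℝ} (hfB : ∀ x, |f x| ≤ B) (x : Fin n → E) :
    |increment ν f k x| ≤ 2 * B := by
  have h1 := hfB (x k)
  have h2 := abs_integral_condLaw_le ν k hfB (past k x)
  rw [increment]
  rw [abs_le] at *
  constructor <;> linarith

lemma integrable_increment_mul {n : ℕ} (ν : ProbabilityMeasure (Fin n → E)) (j k : Fin n)
    {f : E → ℝ} (hf : Measurable f) {B : ℝ} (hfB : ∀ x, |f x| ≤ B) :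
    Integrable (fun x => increment ν f j x * increment ν f k x) (ν : Measure (Fin n → E)) := by
  refine Integrable.of_bound ((measurable_increment ν j hf).mul
    (measurable_increment ν k hf)).aestronglyMeasurable ((2 * B) * (2 * B))
    (ae_of_all _ fun x => ?_)
  rw [Real.norm_eq_abs, abs_mul]
  exact mul_le_mul (abs_increment_le ν j hfB x) (abs_increment_le ν k hfB x) (abs_nonneg _)
    ((abs_nonneg _).trans (abs_increment_le ν j hfB x))

lemma integral_increment_mul_eq_zero_of_lt {n : ℕ} (ν : ProbabilityMeasure (Fin n → E))
    {j k : Fin n} (hjk : j < k) {f : E → ℝ} (hf : Measurable f) {B : ℝ} (hfB : ∀ x, |f x| ≤ B) :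
    ∫ x, increment ν f j x * increment ν f k x ∂(ν : Measure (Fin n → E)) = 0 := by
  let G : (Fin (k : ℕ) → E) → ℝ := fun y => f (y ⟨j, hjk⟩) -
    ∫ z, f z ∂(condLaw n ν j (fun i : Fin (j : ℕ) => y (Fin.castLE (le_of_lt hjk) i)))
  have hG : Measurable G := by
    refine (hf.comp (measurable_pi_apply _)).sub ((measurable_integral_condLaw ν j hf).comp ?_)
    fun_prop
  have hGeq : ∀ x, increment ν f j x = G (past k x) := fun x => rfl
  have hGA : ∀ y, |G y| ≤ 2 * B := by
    intro y
    have h1 := hfB (y ⟨j, hjk⟩)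
    have h2 := abs_integral_condLaw_le ν j hfB
      (fun i : Fin (j : ℕ) => y (Fin.castLE (le_of_lt hjk) i))
    simp only [G]
    rw [abs_le] at *
    constructor <;> linarith
  have hB : 0 ≤ B := (abs_nonneg _).trans (hfB (Classical.arbitrary E))
  have hb : ∀ (g h : (Fin n → E) → ℝ), Measurable g → Measurable h → (∀ x, |g x| ≤ 2 * B) →
      (∀ x, |h x| ≤ B) → Integrable (fun x => g x * h x) (ν : Measure (Fin n → E)) := by
    intro g h hg hh h1 h2
    refine Integrable.of_bound (hg.mul hh).aestronglyMeasurable ((2 * B) * B)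
      (ae_of_all _ fun x => ?_)
    rw [Real.norm_eq_abs, abs_mul]
    exact mul_le_mul (h1 x) (h2 x) (abs_nonneg _) (by positivity)
  simp only [hGeq]
  simp only [increment, mul_sub]
  rw [integral_sub, integral_mul_condLaw ν k hf hfB hG hGA, sub_self]
  · exact hb _ _ (hG.comp (measurable_past k)) (hf.comp (measurable_pi_apply k))
      (fun x => hGA _) (fun x => hfB _)
  · exact hb _ _ (hG.comp (measurable_past k))
      ((measurable_integral_condLaw ν k hf).comp (measurable_past k))
      (fun x => hGA _) (fun x => abs_integral_condLaw_le ν k hfB _)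

lemma integral_increment_mul_eq_zero {n : ℕ} (ν : ProbabilityMeasure (Fin n → E))
    {j k : Fin n} (hjk : j ≠ k) {f : E → ℝ} (hf : Measurable f) {B : ℝ} (hfB : ∀ x, |f x| ≤ B) :
    ∫ x, increment ν f j x * increment ν f k x ∂(ν : Measure (Fin n → E)) = 0 := by
  rcases lt_or_gt_of_ne hjk with h | h
  · exact integral_increment_mul_eq_zero_of_lt ν h hf hfB
  · simp only [mul_comm (increment ν f j _)]
    exact integral_increment_mul_eq_zero_of_lt ν h hf hfB

lemma integral_sq_sum_increment_le {n : ℕ} (ν : ProbabilityMeasure (Fin n → E))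
    {f : E → ℝ} (hf : Measurable f) {B : ℝ} (hfB : ∀ x, |f x| ≤ B) :
    ∫ x, (∑ k, increment ν f k x) ^ 2 ∂(ν : Measure (Fin n → E)) ≤ n * (2 * B) ^ 2 := by
  simp only [pow_two (∑ k, increment ν f k _), Finset.sum_mul_sum]
  rw [integral_finsetSum _ fun j _ => integrable_finsetSum _ fun k _ =>
    integrable_increment_mul ν j k hf hfB]
  calc ∑ j, ∫ x, ∑ k, increment ν f j x * increment ν f k x ∂(ν : Measure (Fin n → E))
      ≤ ∑ j : Fin n, (2 * B) ^ 2 := by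
        refine Finset.sum_le_sum fun j _ => ?_
        rw [integral_finsetSum _ fun k _ => integrable_increment_mul ν j k hf hfB,
          Finset.sum_eq_single j (fun k _ hk => integral_increment_mul_eq_zero ν hk.symm hf hfB)
            (by simp)]
        refine (integral_mono (integrable_increment_mul ν j j hf hfB)
          (integrable_const ((2 * B) ^ 2)) fun x => ?_).trans (by simp)
        have h := abs_increment_le ν j hfB x
        rw [← pow_two]
        exact sq_le_sq.2 (h.trans (le_abs_self _))
    _ = n * (2 * B) ^ 2 := by simp

lemma measure_increment_ge_le {n : ℕ} [NeZero n] (ν : ProbabilityMeasure (Fin n → E))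
    {f : E → ℝ} (hf : Measurable f) {B : ℝ} (hfB : ∀ x, |f x| ≤ B) {δ : ℝ} (hδ : 0 < δ) :
    (ν : Measure (Fin n → E)).real {x | δ ≤ |(n : ℝ)⁻¹ * ∑ k, increment ν f k x|} ≤
      (2 * B) ^ 2 / δ ^ 2 * (n : ℝ)⁻¹ := by
  have hn : (0 : ℝ) < n := by exact_mod_cast Nat.pos_of_ne_zero (NeZero.ne n)
  have h_int : Integrable (fun x => (∑ k, increment ν f k x) ^ 2) (ν : Measure (Fin n → E)) := by
    simp only [pow_two, Finset.sum_mul_sum]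
    exact integrable_finsetSum _ fun j _ => integrable_finsetSum _ fun k _ =>
      integrable_increment_mul ν j k hf hfB
  have h := mul_meas_ge_le_integral_of_nonneg (μ := (ν : Measure (Fin n → E)))
    (ae_of_all _ fun x => sq_nonneg (∑ k, increment ν f k x)) h_int ((n * δ) ^ 2)
  have hset : {x | δ ≤ |(n : ℝ)⁻¹ * ∑ k, increment ν f k x|} =
      {x | (n * δ) ^ 2 ≤ (∑ k, increment ν f k x) ^ 2} := by
    ext x
    simp only [mem_ofPred_eq]
    rw [abs_mul, abs_of_pos (inv_pos.2 hn), sq_le_sq, abs_of_pos (mul_pos hn hδ),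
      le_inv_mul_iff₀ hn]
  rw [hset]
  have h2 := h.trans (integral_sq_sum_increment_le ν hf hfB)
  rw [div_mul_eq_mul_div, le_div_iff₀ (by positivity), ← div_eq_mul_inv, le_div_iff₀ hn]
  refine le_of_mul_le_mul_left (a := (n : ℝ)) ?_ hn
  linarith

open BoundedContinuousFunction in
lemma integral_empirical_sub_uniformMixture {n : ℕ} [NeZero n]
    (ν : ProbabilityMeasure (Fin n → E)) (f : E →ᵇ ℝ) (x : Fin n → E) :
    ∫ y, f y ∂(empirical n x : Measure E)
      - ∫ y, f y ∂(uniformMixture (fun k => condProb ν k x) : Measure E) =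
      (n : ℝ)⁻¹ * ∑ k, increment ν f k x := by
  rw [integral_empirical, integral_uniformMixture _ fun k => f.integrable _, ← mul_sub,
    ← Finset.sum_sub_distrib]
  rfl

/-- With high probability, uniformly over the joint law, the empirical measure is close to the
average of the conditional laws as seen by `F`, whenever the latter average lies in `K`. -/
lemma eventually_exists_exceptional_set {K : Set (ProbabilityMeasure E)} (hK : IsCompact K)
    {F : ProbabilityMeasure E → ℝ} (hF : Continuous F) {ε : ℝ} (hε : 0 < ε) :
    ∃ N : ℕ, ∀ (n : ℕ) [NeZero n], N ≤ n → ∀ ν : ProbabilityMeasure (Fin n → E),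
      ∃ S : Set (Fin n → E), MeasurableSet S ∧ (ν : Measure (Fin n → E)).real S ≤ ε ∧
        ∀ x, x ∉ S → uniformMixture (fun k => condProb ν k x) ∈ K →
          |F (empirical n x) - F (uniformMixture fun k => condProb ν k x)| < ε := by
  obtain ⟨T, δ, hT, hδ, h⟩ := IsCompact.exists_finite_test_functions hK hF hε
  let c : ℝ := ∑ f ∈ hT.toFinset, (2 * ‖f‖) ^ 2 / δ f ^ 2
  have hlim : Tendsto (fun n : ℕ => c * (n : ℝ)⁻¹) atTop (𝓝 0) := by
    simpa using (tendsto_inv_atTop_nhds_zero_nat (𝕜 := ℝ)).const_mul c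
  obtain ⟨N, hN⟩ := eventually_atTop.1 (hlim.eventually_le_const hε)
  refine ⟨N, fun n _ hn ν => ?_⟩
  refine ⟨⋃ f ∈ hT.toFinset, {x | δ f ≤ |(n : ℝ)⁻¹ * ∑ k, increment ν f k x|}, ?_, ?_, ?_⟩
  · refine Finset.measurableSet_biUnion _ fun f _ => measurableSet_le measurable_const ?_
    have := fun k => measurable_increment ν k f.continuous.measurable
    fun_prop
  · refine (measureReal_biUnion_finset_le _ _).trans (le_trans ?_ (hN n hn))
    rw [Finset.sum_mul]
    exact Finset.sum_le_sum fun f hf => measure_increment_ge_le ν f.continuous.measurable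
      (fun x => f.norm_coe_le_norm x) (hδ f (hT.mem_toFinset.1 hf))
  · intro x hx hmem
    refine h _ hmem _ fun f hf => ?_
    rw [integral_empirical_sub_uniformMixture]
    by_contra hcon
    exact hx (mem_iUnion₂.2 ⟨f, hT.mem_toFinset.2 hf, not_lt.1 hcon⟩)

lemma condProb_pi_ae_eq {n : ℕ} (μ : ProbabilityMeasure E) (k : Fin n) :
    ∀ᵐ x ∂(ProbabilityMeasure.pi (fun _ : Fin n => μ) : Measure (Fin n → E)),
      condProb (ProbabilityMeasure.pi fun _ : Fin n => μ) k x = μ := by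
  set ν : ProbabilityMeasure (Fin n → E) := ProbabilityMeasure.pi fun _ : Fin n => μ with hν
  have hνpi : (ν : Measure (Fin n → E)) = Measure.pi fun _ => (μ : Measure E) := rfl
  have hind : iIndepFun (fun (i : Fin n) (x : Fin n → E) => x i) (ν : Measure (Fin n → E)) :=
    iIndepFun_pi (μ := fun _ : Fin n => (μ : Measure E)) (X := fun _ => id)
      fun _ => aemeasurable_id
  have hlt : ∀ i : Fin (k : ℕ), Fin.castLE k.isLt.le i ∈ Finset.Iio k := fun i =>
    Finset.mem_Iio.2 i.isLt
  let φ : (Finset.Iio k → E) → (Fin (k : ℕ) → E) := fun z i => z ⟨_, hlt i⟩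
  let ψ : (({k} : Finset (Fin n)) → E) → E := fun z => z ⟨k, Finset.mem_singleton_self k⟩
  have hφ : Measurable φ := measurable_pi_lambda _ fun i => measurable_pi_apply _
  have hψ : Measurable ψ := measurable_pi_apply _
  have h2 : IndepFun (past k) (fun x : Fin n → E => x k) (ν : Measure (Fin n → E)) :=
    (hind.indepFun_finset (Finset.Iio k) {k} (by simp) fun i => measurable_pi_apply i).comp hφ hψ
  have hmap : (ν : Measure (Fin n → E)).map (fun x => (past k x, x k)) =
      ((ν : Measure (Fin n → E)).map (past k)).prod (μ : Measure E) := by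
    rw [(indepFun_iff_map_prod_eq_prod_map_map (measurable_past k).aemeasurable
      (measurable_pi_apply k).aemeasurable).1 h2]
    congr 1
    exact (measurePreserving_eval (fun _ : Fin n => (μ : Measure E)) k).map_eq
  have : IsProbabilityMeasure ((ν : Measure (Fin n → E)).map (past k)) :=
    Measure.isProbabilityMeasure_map (measurable_past k).aemeasurable
  have hfst : ((ν : Measure (Fin n → E)).map (fun x => (past k x, x k))).fst =
      (ν : Measure (Fin n → E)).map (past k) := Measure.fst_map_prodMk (measurable_pi_apply k)
  have hae := eq_condKernel_of_measure_eq_compProd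
    (ρ := (ν : Measure (Fin n → E)).map (fun x => (past k x, x k)))
    (Kernel.const _ (μ : Measure E)) (by rw [hfst, Measure.compProd_const, hmap])
  rw [hfst] at hae
  filter_upwards [ae_of_ae_map (measurable_past k).aemeasurable hae] with x hx
  exact Subtype.ext hx.symm

lemma measurable_condProb {n : ℕ} {α : ProbabilityMeasure E → EReal} (hbot : ∀ ν, α ν ≠ ⊥)
    (hcompact : ∀ c : ℝ, IsCompact {ν : ProbabilityMeasure E | α ν ≤ (c : EReal)})
    (ν : ProbabilityMeasure (Fin n → E)) (k : Fin n) :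
    Measurable fun x => α (condProb ν k x) := by
  refine measurable_of_Iic fun c => ?_
  induction c with
  | bot =>
    convert MeasurableSet.empty
    ext x
    simpa using hbot _
  | top => simp
  | coe c =>
    exact measurableSet_preimage_of_isCompact (g := condProb ν k)
      (fun f => (measurable_integral_condLaw ν k f.continuous.measurable).comp
        (measurable_past k)) (hcompact c)

end Conditional

section ErealIntegral

variable {X : Type*} [MeasurableSpace X] {μ : Measure X}

lemma erealIntegral_congr_ae {f g : X → EReal} (h : f =ᵐ[μ] g) :
    erealIntegral μ f = erealIntegral μ g := by
  have h1 : ∫⁻ x, (if f x = ⊥ then ⊤ else ENNReal.ofReal (-(f x).toReal)) ∂μ =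
      ∫⁻ x, (if g x = ⊥ then ⊤ else ENNReal.ofReal (-(g x).toReal)) ∂μ :=
    lintegral_congr_ae (h.mono fun x hx => by simp only [hx])
  have h2 : ∫⁻ x, (if f x = ⊤ then ⊤ else ENNReal.ofReal ((f x).toReal)) ∂μ =
      ∫⁻ x, (if g x = ⊤ then ⊤ else ENNReal.ofReal ((g x).toReal)) ∂μ :=
    lintegral_congr_ae (h.mono fun x hx => by simp only [hx])
  rw [erealIntegral, erealIntegral, h1, h2]

lemma erealIntegral_coe {g : X → ℝ} (hg : Integrable g μ) :
    erealIntegral μ (fun x => (g x : EReal)) = ((∫ x, g x ∂μ : ℝ) : EReal) := by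
  have h1 : ∫⁻ x, ENNReal.ofReal (g x) ∂μ ≠ ⊤ := hg.lintegral_lt_top.ne
  have h2 : ∫⁻ x, ENNReal.ofReal (-g x) ∂μ ≠ ⊤ := hg.neg.lintegral_lt_top.ne
  simp only [erealIntegral, EReal.coe_ne_bot, EReal.coe_ne_top, if_false, EReal.toReal_coe]
  rw [if_neg h2, integral_eq_lintegral_pos_part_sub_lintegral_neg_part hg, EReal.coe_sub,
    EReal.coe_ennreal_toReal h1, EReal.coe_ennreal_toReal h2]

variable [IsFiniteMeasure μ]

lemma lintegral_neg_part_ne_top {f : X → EReal} {m : ℝ} (hm : ∀ x, (m : EReal) ≤ f x) :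
    ∫⁻ x, (if f x = ⊥ then ⊤ else ENNReal.ofReal (-(f x).toReal)) ∂μ ≠ ⊤ := by
  refine ne_top_of_le_ne_top (b := ∫⁻ _, ENNReal.ofReal |m| ∂μ) ?_ (lintegral_mono fun x => ?_)
  · rw [lintegral_const]
    exact ENNReal.mul_ne_top ENNReal.ofReal_ne_top (measure_ne_top _ _)
  · have h := hm x
    generalize f x = y at h
    induction y with
    | bot => exact absurd h (by simp)
    | top => simp
    | coe y =>
      rw [EReal.coe_le_coe_iff] at h
      simp only [EReal.coe_ne_bot, if_false, EReal.toReal_coe]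
      exact ENNReal.ofReal_le_ofReal ((neg_le_neg h).trans (neg_le_abs m))

lemma erealIntegral_ne_bot {f : X → EReal} {m : ℝ} (hm : ∀ x, (m : EReal) ≤ f x) :
    erealIntegral μ f ≠ ⊥ := by
  have h := lintegral_neg_part_ne_top (μ := μ) hm
  rw [erealIntegral, if_neg h]
  generalize (∫⁻ x, (if f x = ⊥ then ⊤ else ENNReal.ofReal (-(f x).toReal)) ∂μ) = b at h ⊢
  generalize (∫⁻ x, (if f x = ⊤ then ⊤ else ENNReal.ofReal ((f x).toReal)) ∂μ) = a
  lift b to ℝ≥0 using h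
  rw [sub_eq_add_neg, Ne, EReal.add_eq_bot_iff]
  simp

lemma erealIntegral_of_ne_top {f : X → EReal} (hf : Measurable f) {m : ℝ}
    (hm : ∀ x, (m : EReal) ≤ f x) (hfin : erealIntegral μ f ≠ ⊤) :
    (∀ᵐ x ∂μ, f x ≠ ⊤) ∧ Integrable (fun x => (f x).toReal) μ ∧
      erealIntegral μ f = ((∫ x, (f x).toReal ∂μ : ℝ) : EReal) := by
  have hneg := lintegral_neg_part_ne_top (μ := μ) hm
  have hbot : ∀ x, f x ≠ ⊥ := fun x => ne_bot_of_le_ne_bot (EReal.coe_ne_bot m) (hm x)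
  have hpos : ∫⁻ x, (if f x = ⊤ then ⊤ else ENNReal.ofReal ((f x).toReal)) ∂μ ≠ ⊤ := by
    intro htop
    apply hfin
    rw [erealIntegral, if_neg hneg, htop]
    generalize (∫⁻ x, (if f x = ⊥ then ⊤ else ENNReal.ofReal (-(f x).toReal)) ∂μ) = b at hneg
    lift b to ℝ≥0 using hneg
    rfl
  have hmeas : Measurable fun x => if f x = ⊤ then ⊤ else ENNReal.ofReal ((f x).toReal) :=
    Measurable.ite (hf (measurableSet_singleton ⊤)) measurable_const
      hf.ereal_toReal.ennreal_ofReal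
  have hae : ∀ᵐ x ∂μ, f x ≠ ⊤ := by
    filter_upwards [ae_lt_top hmeas hpos] with x hx h
    simp [h] at hx
  have h_int : Integrable (fun x => (f x).toReal) μ := by
    refine ⟨hf.ereal_toReal.aestronglyMeasurable, ?_⟩
    rw [hasFiniteIntegral_iff_norm]
    calc ∫⁻ x, ENNReal.ofReal ‖(f x).toReal‖ ∂μ
        ≤ ∫⁻ x, ((if f x = ⊤ then ⊤ else ENNReal.ofReal ((f x).toReal)) +
            (if f x = ⊥ then ⊤ else ENNReal.ofReal (-(f x).toReal))) ∂μ := by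
          refine lintegral_mono fun x => ?_
          simp only [hbot x, if_false]
          rcases le_total 0 (f x).toReal with h | h
          · rw [Real.norm_of_nonneg h]
            refine le_add_right ?_
            split_ifs <;> simp
          · rw [Real.norm_of_nonpos h]
            exact le_add_self
      _ < ⊤ := by
          rw [lintegral_add_left hmeas]
          exact ENNReal.add_lt_top.2 ⟨hpos.lt_top, hneg.lt_top⟩
  refine ⟨hae, h_int, ?_⟩
  rw [← erealIntegral_coe h_int]
  exact erealIntegral_congr_ae (hae.mono fun x hx => (EReal.coe_toReal hx (hbot x)).symm)

end ErealIntegral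

lemma ereal_sum_ne_bot {ι : Type*} (s : Finset ι) {b : ι → EReal} (hb : ∀ i, b i ≠ ⊥) :
    ∑ i ∈ s, b i ≠ ⊥ := by
  induction s using Finset.induction_on with
  | empty => simp
  | insert i s hi ih =>
    rw [Finset.sum_insert hi, Ne, EReal.add_eq_bot_iff]
    simp [hb i, ih]

lemma ereal_ne_top_of_sum_ne_top {ι : Type*} [Fintype ι] {b : ι → EReal}
    (hb : ∀ i, b i ≠ ⊥) (h : ∑ i, b i ≠ ⊤) (i : ι) : b i ≠ ⊤ := by
  intro hi
  apply h
  rw [← Finset.add_sum_erase _ _ (Finset.mem_univ i), hi]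
  exact EReal.top_add_of_ne_bot (ereal_sum_ne_bot _ hb)

lemma ereal_coe_sum {ι : Type*} (s : Finset ι) (b : ι → ℝ) :
    ((∑ i ∈ s, b i : ℝ) : EReal) = ∑ i ∈ s, (b i : EReal) := by
  induction s using Finset.induction_on with
  | empty => simp
  | insert i s hi ih => rw [Finset.sum_insert hi, Finset.sum_insert hi, EReal.coe_add, ih]

section Main

variable [PolishSpace E] [BorelSpace E] [Nonempty E]

lemma alphan_eq_sum_condProb (α : ProbabilityMeasure E → EReal) {n : ℕ}
    (ν : ProbabilityMeasure (Fin n → E)) :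
    alphan α n ν = ∑ k, erealIntegral (ν : Measure (Fin n → E))
      (fun x => α (condProb ν k x)) := by
  refine Finset.sum_congr rfl fun k _ => ?_
  congr 1
  ext1 x
  exact extend_coe α (condProb ν k x)

lemma integrable_comp_empirical {n : ℕ} [NeZero n] (ν : ProbabilityMeasure (Fin n → E))
    {F : ProbabilityMeasure E → ℝ} (hF : Continuous F) {C : ℝ} (hC : ∀ ν, |F ν| ≤ C) :
    Integrable (fun x => F (empirical n x)) (ν : Measure (Fin n → E)) :=
  Integrable.of_bound (hF.comp continuous_empirical).measurable.aestronglyMeasurable C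
    (ae_of_all _ fun _ => hC _)

lemma erealIntegral_comp_empirical {n : ℕ} [NeZero n] (ν : ProbabilityMeasure (Fin n → E))
    {F : ProbabilityMeasure E → ℝ} (hF : Continuous F) {C : ℝ} (hC : ∀ ν, |F ν| ≤ C) :
    erealIntegral (ν : Measure (Fin n → E))
        (fun x => (((n : ℝ) * F (empirical n x) : ℝ) : EReal)) =
      ((n * ∫ x, F (empirical n x) ∂(ν : Measure (Fin n → E)) : ℝ) : EReal) := by
  rw [erealIntegral_coe ((integrable_comp_empirical ν hF hC).const_mul _), integral_const_mul]

lemma alphan_pi {n : ℕ} (α : ProbabilityMeasure E → EReal) (μ : ProbabilityMeasure E) {r : ℝ}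
    (hr : α μ = r) :
    alphan α n (ProbabilityMeasure.pi fun _ : Fin n => μ) = ((n * r : ℝ) : EReal) := by
  rw [alphan_eq_sum_condProb]
  have h : ∀ k : Fin n, erealIntegral
      (ProbabilityMeasure.pi (fun _ : Fin n => μ) : Measure (Fin n → E))
      (fun x => α (condProb (ProbabilityMeasure.pi fun _ : Fin n => μ) k x)) = (r : EReal) := by
    intro k
    rw [erealIntegral_congr_ae (g := fun _ => (r : EReal))
      ((condProb_pi_ae_eq μ k).mono fun x hx => by simp only [hx, hr]),
      erealIntegral_coe (integrable_const r)]
    simp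
  rw [Finset.sum_congr rfl fun k _ => h k, ← ereal_coe_sum]
  simp

lemma eventually_le_rhon {α : ProbabilityMeasure E → EReal}
    {F : ProbabilityMeasure E → ℝ} (hF : Continuous F) {C : ℝ} (hC : ∀ ν, |F ν| ≤ C)
    {μ : ProbabilityMeasure E} {r : ℝ} (hr : α μ = r) {ε : ℝ} (hε : 0 < ε) :
    ∃ N : ℕ, ∀ (n : ℕ) [NeZero n], N ≤ n →
      ((n * (F μ - r - ε - 2 * C * ε) : ℝ) : EReal) ≤
        rhon α n (fun x => (((n : ℝ) * F (empirical n x) : ℝ) : EReal)) := by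
  have hC0 : 0 ≤ C := (abs_nonneg _).trans (hC μ)
  obtain ⟨N, hN⟩ := eventually_exists_exceptional_set (isCompact_singleton (x := μ)) hF hε
  refine ⟨N, fun n _ hn => ?_⟩
  obtain ⟨S, hS, hSε, h⟩ := hN n hn (ProbabilityMeasure.pi fun _ => μ)
  refine le_trans ?_ (le_iSup _ (ProbabilityMeasure.pi fun _ => μ))
  rw [erealIntegral_comp_empirical _ hF hC, alphan_pi α μ hr, ← EReal.coe_sub,
    EReal.coe_le_coe_iff, ← mul_sub]
  refine mul_le_mul_of_nonneg_left ?_ (Nat.cast_nonneg n)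
  set ν : ProbabilityMeasure (Fin n → E) := ProbabilityMeasure.pi fun _ => μ
  have hae : ∀ᵐ x ∂(ν : Measure (Fin n → E)),
      F μ - ε - S.indicator (fun _ => 2 * C) x ≤ F (empirical n x) := by
    filter_upwards [ae_all_iff.2 fun k => condProb_pi_ae_eq (n := n) μ k] with x hx
    have hmix : uniformMixture (fun k => condProb ν k x) = μ := by
      rw [funext hx, uniformMixture_const]
    have h1 := abs_le.1 (hC μ)
    have h2 := abs_le.1 (hC (empirical n x))
    by_cases hxS : x ∈ S
    · rw [indicator_of_mem hxS]; linarith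
    · rw [indicator_of_notMem hxS]
      have h3 := h x hxS (by rw [hmix]; rfl)
      rw [hmix] at h3
      linarith [(abs_lt.1 h3).1]
  have hind : Integrable (S.indicator fun _ => 2 * C) (ν : Measure (Fin n → E)) :=
    (integrable_const _).indicator hS
  have h_int := integral_mono_ae ((integrable_const (F μ - ε)).sub hind)
    (integrable_comp_empirical ν hF hC) hae
  rw [integral_sub' (integrable_const _) hind, integral_indicator_const _ hS] at h_int
  simp only [integral_const, probReal_univ, smul_eq_mul, one_mul] at h_int
  have := mul_le_mul_of_nonneg_right hSε (by positivity : 0 ≤ 2 * C)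
  linarith

lemma eventually_rhon_le {α : ProbabilityMeasure E → EReal} (hbot : ∀ ν, α ν ≠ ⊥)
    (hconvex : ∀ (μ₁ μ₂ : ProbabilityMeasure E) (t : ℝ≥0), t ≤ 1 →
      extend α ((t : ℝ≥0∞) • (μ₁ : Measure E) + ((1 - t : ℝ≥0) : ℝ≥0∞) • (μ₂ : Measure E))
        ≤ ((t : ℝ) : EReal) * α μ₁ + (((1 - t : ℝ≥0) : ℝ) : EReal) * α μ₂)
    (hcompact : ∀ c : ℝ, IsCompact {ν : ProbabilityMeasure E | α ν ≤ (c : EReal)})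
    {F : ProbabilityMeasure E → ℝ} (hF : Continuous F) {C : ℝ} (hC : ∀ ν, |F ν| ≤ C)
    {M : ℝ} (hM : ∀ ν (r : ℝ), α ν ≤ r → F ν ≤ M + r) {ε : ℝ} (hε : 0 < ε) :
    ∃ N : ℕ, ∀ (n : ℕ) [NeZero n], N ≤ n →
      rhon α n (fun x => (((n : ℝ) * F (empirical n x) : ℝ) : EReal)) ≤
        ((n * (M + ε + 2 * C * ε) : ℝ) : EReal) := by
  obtain ⟨m, hm⟩ := exists_le_of_isCompact_sublevel hbot hcompact
  have hC0 : 0 ≤ C :=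
    (abs_nonneg _).trans (hC ⟨Measure.dirac (Classical.arbitrary E), inferInstance⟩)
  obtain ⟨N, hN⟩ := eventually_exists_exceptional_set (hcompact (C - M)) hF hε
  refine ⟨N, fun n _ hn => iSup_le fun ν => ?_⟩
  have hn0 : (0 : ℝ) < n := by exact_mod_cast Nat.pos_of_ne_zero (NeZero.ne n)
  obtain ⟨S, hS, hSε, h⟩ := hN n hn ν
  rw [erealIntegral_comp_empirical _ hF hC, alphan_eq_sum_condProb]
  by_cases htop : ∑ k, erealIntegral (ν : Measure (Fin n → E)) (fun x => α (condProb ν k x)) = ⊤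
  · rw [htop, EReal.sub_top]; exact bot_le
  have hfin := ereal_ne_top_of_sum_ne_top
    (fun k => erealIntegral_ne_bot (fun x => hm (condProb ν k x))) htop
  have hk := fun k => erealIntegral_of_ne_top (measurable_condProb hbot hcompact ν k)
    (fun x => hm _) (hfin k)
  rw [Finset.sum_congr rfl fun k _ => (hk k).2.2, ← ereal_coe_sum, ← EReal.coe_sub,
    EReal.coe_le_coe_iff]
  let A : (Fin n → E) → ℝ := fun x => (n : ℝ)⁻¹ * ∑ k, (α (condProb ν k x)).toReal
  have hA : Integrable A (ν : Measure (Fin n → E)) :=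
    (integrable_finsetSum _ fun k _ => (hk k).2.1).const_mul _
  have hAint : n * ∫ x, A x ∂(ν : Measure (Fin n → E)) =
      ∑ k, ∫ x, (α (condProb ν k x)).toReal ∂(ν : Measure (Fin n → E)) := by
    rw [integral_const_mul, integral_finsetSum _ fun k _ => (hk k).2.1,
      mul_inv_cancel_left₀ hn0.ne']
  rw [← hAint, ← mul_sub]
  refine mul_le_mul_of_nonneg_left ?_ hn0.le
  have hae : ∀ᵐ x ∂(ν : Measure (Fin n → E)),
      F (empirical n x) ≤ A x + (M + ε + S.indicator (fun _ => 2 * C) x) := by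
    filter_upwards [ae_all_iff.2 fun k => (hk k).1] with x hx
    have hJ : α (uniformMixture fun k => condProb ν k x) ≤ (A x : EReal) :=
      le_average_of_convex hconvex _ _ fun k => EReal.le_coe_toReal (hx k)
    have h0 := hM _ _ hJ
    have h1 := abs_le.1 (hC (uniformMixture fun k => condProb ν k x))
    have h2 := abs_le.1 (hC (empirical n x))
    by_cases hxS : x ∈ S
    · rw [indicator_of_mem hxS]; linarith
    · rw [indicator_of_notMem hxS]
      by_cases hxK : α (uniformMixture fun k => condProb ν k x) ≤ ((C - M : ℝ) : EReal)
      · linarith [(abs_lt.1 (h x hxS hxK)).2]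
      · have := (EReal.coe_lt_coe_iff.1 ((not_le.1 hxK).trans_le hJ)).le
        linarith
  have hind : Integrable (S.indicator fun _ => 2 * C) (ν : Measure (Fin n → E)) :=
    (integrable_const _).indicator hS
  have hrest : Integrable (fun x => M + ε + S.indicator (fun _ => 2 * C) x)
      (ν : Measure (Fin n → E)) := (integrable_const _).add hind
  have h_int := integral_mono_ae (integrable_comp_empirical ν hF hC) (hA.add hrest) hae
  rw [integral_add' hA hrest, integral_add (integrable_const _) hind,
    integral_indicator_const _ hS] at h_int
  simp only [integral_const, probReal_univ, smul_eq_mul, one_mul] at h_int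
  have := mul_le_mul_of_nonneg_right hSε (by positivity : 0 ≤ 2 * C)
  linarith

omit [TopologicalSpace E] [PolishSpace E] [BorelSpace E] [Nonempty E] in
lemma exists_real_eq_iSup {α : ProbabilityMeasure E → EReal} (hproper : ∃ ν, α ν ≠ ⊤)
    (hbot : ∀ ν, α ν ≠ ⊥) {m : ℝ} (hm : ∀ ν, (m : EReal) ≤ α ν)
    {F : ProbabilityMeasure E → ℝ} {C : ℝ} (hC : ∀ ν, |F ν| ≤ C) :
    ∃ M : ℝ, (⨆ ν : ProbabilityMeasure E, ((F ν : ℝ) : EReal) - α ν) = (M : EReal) := by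
  obtain ⟨ν₀, hν₀⟩ := hproper
  refine ⟨_, (EReal.coe_toReal ?_ ?_).symm⟩
  · refine ne_top_of_le_ne_top (EReal.coe_ne_top (C - m)) (iSup_le fun ν => ?_)
    rw [EReal.coe_sub]
    exact EReal.sub_le_sub (EReal.coe_le_coe_iff.2 ((le_abs_self _).trans (hC ν))) (hm ν)
  · refine ne_bot_of_le_ne_bot ?_ (le_iSup _ ν₀)
    rw [← EReal.coe_toReal hν₀ (hbot ν₀), ← EReal.coe_sub]
    exact EReal.coe_ne_bot _

end Main

end ProbabilityMeasures

/-- **Theorem 1.1.** For every bounded continuous `F` on `P(E)`,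
`lim_n (1/n) ρ_n(n F ∘ L_n) = sup_ν (F(ν) − α(ν))`. -/
theorem sanov_laplace_principle
    {E : Type*} [MeasurableSpace E] [TopologicalSpace E] [PolishSpace E] [BorelSpace E]
    [Nonempty E]
    (α : ProbabilityMeasure E → EReal)
    (hproper : ∃ ν, α ν ≠ ⊤) (hbot : ∀ ν, α ν ≠ ⊥)
    (hconvex : ∀ (μ₁ μ₂ : ProbabilityMeasure E) (t : ℝ≥0), t ≤ 1 →
      extend α ((t : ℝ≥0∞) • (μ₁ : Measure E) + ((1 - t : ℝ≥0) : ℝ≥0∞) • (μ₂ : Measure E))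
        ≤ ((t : ℝ) : EReal) * α μ₁ + (((1 - t : ℝ≥0) : ℝ) : EReal) * α μ₂)
    (hcompact : ∀ c : ℝ, IsCompact {ν : ProbabilityMeasure E | α ν ≤ (c : EReal)})
    (F : ProbabilityMeasure E → ℝ) (hFcont : Continuous F) (hFbdd : ∃ C : ℝ, ∀ ν, |F ν| ≤ C) :
    Filter.Tendsto
      (fun n : ℕ => (((n : ℝ)⁻¹ : ℝ) : EReal) *
        rhon α n (fun x => (((n : ℝ) * F (empirical n x) : ℝ) : EReal)))
      Filter.atTop
      (𝓝 (⨆ ν : ProbabilityMeasure E, ((F ν : ℝ) : EReal) - α ν)) := by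
  obtain ⟨C, hC⟩ := hFbdd
  obtain ⟨m, hm⟩ := exists_le_of_isCompact_sublevel hbot hcompact
  obtain ⟨M, hMsup⟩ := exists_real_eq_iSup hproper hbot hm hC
  have hC0 : 0 ≤ C := (abs_nonneg _).trans (hC hproper.choose)
  have hM : ∀ ν (r : ℝ), α ν ≤ r → F ν ≤ M + r := by
    intro ν r hr
    have h1 : ((F ν : ℝ) : EReal) - r ≤ M :=
      (EReal.sub_le_sub le_rfl hr).trans
        ((le_iSup (fun ν => ((F ν : ℝ) : EReal) - α ν) ν).trans hMsup.le)
    rw [← EReal.coe_sub, EReal.coe_le_coe_iff] at h1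
    linarith
  rw [hMsup]
  refine tendsto_order.2 ⟨fun a ha => ?_, fun b hb => ?_⟩
  · have ha' := ha
    rw [← hMsup] at ha'
    obtain ⟨μ, hμ⟩ := lt_iSup_iff.1 ha'
    have hμtop : α μ ≠ ⊤ := by
      intro h
      rw [h, EReal.sub_top] at hμ
      exact not_lt_bot hμ
    have hr := (EReal.coe_toReal hμtop (hbot μ)).symm
    set r := (α μ).toReal
    rw [hr, ← EReal.coe_sub] at hμ
    obtain ⟨a', haa', ha'⟩ := EReal.lt_iff_exists_real_btwn.1 hμ
    rw [EReal.coe_lt_coe_iff] at ha'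
    have hpos : 0 < (F μ - r - a') / (1 + 2 * C) := div_pos (by linarith) (by linarith)
    obtain ⟨N, hN⟩ := eventually_le_rhon hFcont hC hr hpos
    filter_upwards [eventually_ge_atTop N, eventually_gt_atTop 0] with n hn hn0
    have : NeZero n := ⟨hn0.ne'⟩
    have hn0' : (0 : ℝ) < n := by exact_mod_cast hn0
    refine haa'.trans_le (le_trans ?_ (mul_le_mul_of_nonneg_left (hN n hn)
      (EReal.coe_nonneg.2 (inv_nonneg.2 hn0'.le))))
    rw [← EReal.coe_mul, inv_mul_cancel_left₀ hn0'.ne', EReal.coe_le_coe_iff]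
    field_simp
    linarith
  · obtain ⟨b', hbb, hb'⟩ := EReal.lt_iff_exists_real_btwn.1 hb
    rw [EReal.coe_lt_coe_iff] at hbb
    have hpos : 0 < (b' - M) / (1 + 2 * C) := div_pos (by linarith) (by linarith)
    obtain ⟨N, hN⟩ := eventually_rhon_le hbot hconvex hcompact hFcont hC hM hpos
    filter_upwards [eventually_ge_atTop N, eventually_gt_atTop 0] with n hn hn0
    have : NeZero n := ⟨hn0.ne'⟩
    have hn0' : (0 : ℝ) < n := by exact_mod_cast hn0
    refine lt_of_le_of_lt ((mul_le_mul_of_nonneg_left (hN n hn)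
      (EReal.coe_nonneg.2 (inv_nonneg.2 hn0'.le))).trans ?_) hb'
    rw [← EReal.coe_mul, inv_mul_cancel_left₀ hn0'.ne', EReal.coe_le_coe_iff]
    field_simp
    linarith

end SanovDual
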